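/- arXiv:2511.22406 — 2 statements merged into one kernel-verified Lean document; each statement's English description precedes it below -/
import Mathlib

section
/- Let μ ∈ ℝ, σ > 0, and l < u be reals. Let f be the density of the normal distribution N(μ, σ²), let φ and Φ denote the probability density function and cumulative distribution function of the standard normal distribution, and set l' = (l − μ)/σ, u' = (u − μ)/σ, and Z = Φ(u') − Φ(l'). Then the differential entropy of the Gaussian density truncated to [l,u] is H(f(·; [l,u])) = (1/2)·log(2π e σ²) + log Z − (u'·φ(u') − l'·φ(l'))/(2Z). -/
open MeasureTheory Real

/-- The affine change of variables `y = (x - μ) / σ` in an interval integral. -/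
theorem intervalIntegral_comp_sub_div_const (G : ℝ → ℝ) (μ σ l u : ℝ) (hσ : σ ≠ 0) :
    ∫ x in l..u, G ((x - μ) / σ) = σ * ∫ y in ((l - μ) / σ)..((u - μ) / σ), G y := by
  rw [intervalIntegral.integral_comp_sub_right (fun x => G (x / σ)) μ,
    intervalIntegral.integral_comp_div G hσ, smul_eq_mul]

/-- Integration by parts for the truncated second moment of an unnormalized Gaussian. -/
theorem intervalIntegral_mul_exp_mul_sq (c a b : ℝ) :
    ∫ y in a..b, c * exp (-y ^ 2 / 2) * y ^ 2
      = (∫ y in a..b, c * exp (-y ^ 2 / 2))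
        - (b * (c * exp (-b ^ 2 / 2)) - a * (c * exp (-a ^ 2 / 2))) := by
  have hderiv : ∀ y : ℝ, HasDerivAt (fun y => y * (c * exp (-y ^ 2 / 2)))
      (c * exp (-y ^ 2 / 2) - c * exp (-y ^ 2 / 2) * y ^ 2) y := by
    intro y
    have h1 : HasDerivAt (fun y : ℝ => -y ^ 2 / 2) (-y) y := by
      refine (((hasDerivAt_id y).pow 2).neg.div_const 2).congr_deriv ?_
      simp only [id]
      norm_num
      ring
    refine ((hasDerivAt_id y).mul (h1.exp.const_mul c)).congr_deriv ?_
    simp only [id]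
    ring
  have hg : Continuous fun y : ℝ => c * exp (-y ^ 2 / 2) := by fun_prop
  have hg2 : Continuous fun y : ℝ => c * exp (-y ^ 2 / 2) * y ^ 2 := by fun_prop
  have h := intervalIntegral.integral_eq_sub_of_hasDerivAt (a := a) (b := b)
    (fun y _ => hderiv y) ((hg.sub hg2).intervalIntegrable a b)
  rw [intervalIntegral.integral_sub (hg.intervalIntegrable a b) (hg2.intervalIntegrable a b)] at h
  linarith

theorem integrable_const_mul_exp_neg_sq_div_two (c : ℝ) :
    Integrable fun x : ℝ => c * exp (-x ^ 2 / 2) := by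
  refine ((integrable_exp_neg_mul_sq (b := 1 / 2) (by norm_num)).const_mul c).congr ?_
  refine Filter.Eventually.of_forall fun x => ?_
  dsimp only
  congr 2
  ring

/-- Closed-form differential entropy of a Gaussian density truncated to `[l,u]`:
`H(f(·;[l,u])) = (1/2) log (2π e σ²) + log Z - (u' φ(u') - l' φ(l')) / (2 Z)`,
where `l' = (l-μ)/σ`, `u' = (u-μ)/σ` and `Z = Φ(u') - Φ(l')`. -/
theorem stmt6 (μ σ l u : ℝ) (hσ : 0 < σ) (hlu : l < u)
    (f : ℝ → ℝ)
    (hf : f = fun x => (σ * Real.sqrt (2 * π))⁻¹ * Real.exp (-(x - μ) ^ 2 / (2 * σ ^ 2)))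
    (φ : ℝ → ℝ) (hφ : φ = fun x => (Real.sqrt (2 * π))⁻¹ * Real.exp (-x ^ 2 / 2))
    (Φ : ℝ → ℝ) (hΦ : Φ = fun t => ∫ x in Set.Iic t, φ x)
    (l' u' : ℝ) (hl' : l' = (l - μ) / σ) (hu' : u' = (u - μ) / σ)
    (Z : ℝ) (hZ : Z = Φ u' - Φ l') :
    (-∫ x, ((Set.Icc l u).indicator f x / (∫ t in Set.Icc l u, f t)) *
        Real.log ((Set.Icc l u).indicator f x / (∫ t in Set.Icc l u, f t)))
      = 1 / 2 * Real.log (2 * π * Real.exp 1 * σ ^ 2) + Real.log Z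
        - (u' * φ u' - l' * φ l') / (2 * Z) := by
  have hσ0 : σ ≠ 0 := hσ.ne'
  have hs : 0 < Real.sqrt (2 * π) := Real.sqrt_pos.2 (by positivity)
  have hlu' : l' < u' := by
    rw [hl', hu']
    gcongr
  have hφc : Continuous φ := by
    rw [hφ]
    fun_prop
  have hφpos : ∀ x, 0 < φ x := by
    intro x
    rw [hφ]
    positivity
  have hφint : Integrable φ := by
    rw [hφ]
    exact integrable_const_mul_exp_neg_sq_div_two _
  have hZint : ∫ y in l'..u', φ y = Z := by
    rw [hZ, hΦ]
    exact (intervalIntegral.integral_Iic_sub_Iic hφint.integrableOn hφint.integrableOn).symm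
  have hZpos : 0 < Z := by
    rw [← hZint]
    exact intervalIntegral.intervalIntegral_pos_of_pos (hφc.intervalIntegrable _ _) hφpos hlu'
  have hfφ : ∀ x, f x = σ⁻¹ * φ ((x - μ) / σ) := by
    intro x
    rw [hf, hφ]
    dsimp only
    rw [mul_inv, mul_assoc]
    congr 3
    field_simp
  have hfZ : ∫ t in Set.Icc l u, f t = Z := by
    rw [integral_Icc_eq_integral_Ioc, ← intervalIntegral.integral_of_le hlu.le]
    simp_rw [hfφ]
    rw [intervalIntegral_comp_sub_div_const (fun y => σ⁻¹ * φ y) μ σ l u hσ0,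
      intervalIntegral.integral_const_mul, ← hl', ← hu', hZint]
    field_simp
  have hlog : ∀ y, Real.log (σ⁻¹ * φ y / Z)
      = -(Real.log σ + 1 / 2 * Real.log (2 * π) + Real.log Z) - y ^ 2 / 2 := by
    intro y
    rw [Real.log_div (mul_pos (inv_pos.2 hσ) (hφpos y)).ne' hZpos.ne',
      Real.log_mul (inv_pos.2 hσ).ne' (hφpos y).ne', hφ]
    dsimp only
    rw [Real.log_mul (inv_pos.2 hs).ne' (Real.exp_pos _).ne', Real.log_exp, Real.log_inv,
      Real.log_inv, Real.log_sqrt (by positivity)]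
    ring
  set C := Real.log σ + 1 / 2 * Real.log (2 * π) + Real.log Z with hC
  have hmoment : ∫ y in l'..u', φ y * y ^ 2 = Z - (u' * φ u' - l' * φ l') := by
    rw [← hZint, hφ]
    exact intervalIntegral_mul_exp_mul_sq _ _ _
  have hindicator : (fun x => ((Set.Icc l u).indicator f x / Z) *
      Real.log ((Set.Icc l u).indicator f x / Z))
      = (Set.Icc l u).indicator fun x => (f x / Z) * Real.log (f x / Z) := by
    funext x
    by_cases hx : x ∈ Set.Icc l u <;> simp [hx]
  have hintegral : ∫ y in l'..u', (σ⁻¹ * φ y / Z) * Real.log (σ⁻¹ * φ y / Z)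
      = (σ⁻¹ / Z) * (-C * Z - (Z - (u' * φ u' - l' * φ l')) / 2) := by
    have hfun : (fun y => (σ⁻¹ * φ y / Z) * Real.log (σ⁻¹ * φ y / Z))
        = fun y => (σ⁻¹ / Z) * (-C * φ y - φ y * y ^ 2 / 2) := by
      funext y
      rw [hlog]
      ring
    rw [hfun, intervalIntegral.integral_const_mul, intervalIntegral.integral_sub
      (Continuous.intervalIntegrable (by fun_prop) _ _)
      (Continuous.intervalIntegrable (by fun_prop) _ _),
      intervalIntegral.integral_const_mul, intervalIntegral.integral_div, hZint, hmoment]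
  rw [hfZ, hindicator, integral_indicator measurableSet_Icc, integral_Icc_eq_integral_Ioc,
    ← intervalIntegral.integral_of_le hlu.le]
  simp_rw [hfφ]
  rw [intervalIntegral_comp_sub_div_const
      (fun y => (σ⁻¹ * φ y / Z) * Real.log (σ⁻¹ * φ y / Z)) μ σ l u hσ0,
    ← hl', ← hu', hintegral, Real.log_mul (by positivity) (by positivity),
    Real.log_mul (by positivity) (by positivity), Real.log_exp, Real.log_pow, hC]
  push_cast
  field_simp
  ring
end

section
/- Let f be the density of the normal distribution N(μ, σ²) with σ > 0, and let [l, u] ⊆ [l', u'] be nested compact intervals with l' ≤ l < u ≤ u'. Then the differential entropy of the truncated distribution is monotone in the truncation interval: H(f(·; [l, u])) ≤ H(f(·; [l', u'])). -/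
open MeasureTheory

/-- The differential entropy of the density proportional to `exp (-φ)` on `[a, b]`. -/
noncomputable def truncatedGibbsEntropy (φ : ℝ → ℝ) (a b : ℝ) : ℝ :=
  Real.log (∫ x in a..b, Real.exp (-φ x)) +
    (∫ x in a..b, φ x * Real.exp (-φ x)) / ∫ x in a..b, Real.exp (-φ x)

theorem integral_exp_neg_pos {φ : ℝ → ℝ} (hφ : Continuous φ) {a b : ℝ} (hab : a < b) :
    0 < ∫ x in a..b, Real.exp (-φ x) :=
  intervalIntegral.intervalIntegral_pos_of_pos
    (Continuous.intervalIntegrable (by fun_prop) _ _) (fun _ => Real.exp_pos _) hab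

/-- If `φ` lies above its tangent lines, then the mean of `φ` under the density proportional to
`exp (-φ)` on `[a, b]` is at most `φ b + 1`. -/
theorem integral_mul_exp_neg_le {φ φ' : ℝ → ℝ} (hd : ∀ x, HasDerivAt φ (φ' x) x)
    (hc : Continuous φ') (ht : ∀ x y, φ x + φ' x * (y - x) ≤ φ y) {a b : ℝ} (hab : a ≤ b) :
    ∫ x in a..b, φ x * Real.exp (-φ x) ≤ (φ b + 1) * ∫ x in a..b, Real.exp (-φ x) := by
  have hφ : Continuous φ := continuous_iff_continuousAt.2 fun x => (hd x).continuousAt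
  have hF : ∀ x, HasDerivAt (fun x => (b - x) * Real.exp (-φ x))
      (-1 * Real.exp (-φ x) + (b - x) * (Real.exp (-φ x) * -φ' x)) x := fun x =>
    ((hasDerivAt_id x).const_sub b).mul (hd x).neg.exp
  have hFint := intervalIntegral.integral_eq_sub_of_hasDerivAt (a := a) (b := b)
    (fun x _ => hF x) (Continuous.intervalIntegrable (by fun_prop) _ _)
  have hmono : ∫ x in a..b, φ x * Real.exp (-φ x) ≤
      ∫ x in a..b, ((φ b + 1) * Real.exp (-φ x) +
        (-1 * Real.exp (-φ x) + (b - x) * (Real.exp (-φ x) * -φ' x))) := by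
    refine intervalIntegral.integral_mono_on hab (Continuous.intervalIntegrable (by fun_prop) _ _)
      (Continuous.intervalIntegrable (by fun_prop) _ _) fun x _ => ?_
    nlinarith [mul_le_mul_of_nonneg_right (ht x b) (Real.exp_pos (-φ x)).le]
  rw [intervalIntegral.integral_add (Continuous.intervalIntegrable (by fun_prop) _ _)
    (Continuous.intervalIntegrable (by fun_prop) _ _), hFint,
    intervalIntegral.integral_const_mul] at hmono
  have := mul_nonneg (sub_nonneg.2 hab) (Real.exp_pos (-φ a)).le
  simp only [sub_self, zero_mul] at hmono
  linarith

theorem truncatedGibbsEntropy_mono_right {φ φ' : ℝ → ℝ} (hd : ∀ x, HasDerivAt φ (φ' x) x)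
    (hc : Continuous φ') (ht : ∀ x y, φ x + φ' x * (y - x) ≤ φ y) {a b c : ℝ} (hab : a < b)
    (hbc : b ≤ c) : truncatedGibbsEntropy φ a b ≤ truncatedGibbsEntropy φ a c := by
  have hφ : Continuous φ := continuous_iff_continuousAt.2 fun x => (hd x).continuousAt
  have hderiv : ∀ x, a < x → ∃ d, 0 ≤ d ∧ HasDerivAt (truncatedGibbsEntropy φ a) d x := by
    intro x hx
    have hZ := integral_exp_neg_pos hφ hx
    have hdZ : HasDerivAt (fun y => ∫ t in a..y, Real.exp (-φ t)) (Real.exp (-φ x)) x :=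
      (Continuous.integral_hasStrictDerivAt (by fun_prop) a x).hasDerivAt
    have hdW : HasDerivAt (fun y => ∫ t in a..y, φ t * Real.exp (-φ t))
        (φ x * Real.exp (-φ x)) x :=
      (Continuous.integral_hasStrictDerivAt (by fun_prop) a x).hasDerivAt
    refine ⟨_, ?_, (hdZ.log hZ.ne').add (hdW.div hdZ hZ.ne')⟩
    have key := integral_mul_exp_neg_le hd hc ht hx.le
    set Z := ∫ t in a..x, Real.exp (-φ t)
    set W := ∫ t in a..x, φ t * Real.exp (-φ t)
    have : Real.exp (-φ x) / Z +
        (φ x * Real.exp (-φ x) * Z - W * Real.exp (-φ x)) / Z ^ 2 =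
        Real.exp (-φ x) * ((φ x + 1) * Z - W) / Z ^ 2 := by
      field_simp
      ring
    rw [this]
    have := sub_nonneg.2 key
    positivity
  have hmono : MonotoneOn (truncatedGibbsEntropy φ a) (Set.Ioi a) := by
    refine monotoneOn_of_deriv_nonneg (convex_Ioi a) (fun x hx => ?_) (fun x hx => ?_)
      fun x hx => ?_
    · obtain ⟨d, -, h⟩ := hderiv x hx
      exact h.continuousAt.continuousWithinAt
    · obtain ⟨d, -, h⟩ := hderiv x (interior_subset hx)
      exact h.differentiableAt.differentiableWithinAt
    · obtain ⟨d, h0, h⟩ := hderiv x (interior_subset hx)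
      exact h.deriv ▸ h0
  exact hmono hab (hab.trans_le hbc) hbc

theorem truncatedGibbsEntropy_comp_neg (φ : ℝ → ℝ) (a b : ℝ) :
    truncatedGibbsEntropy (fun x => φ (-x)) (-b) (-a) = truncatedGibbsEntropy φ a b := by
  simp only [truncatedGibbsEntropy]
  rw [intervalIntegral.integral_comp_neg (fun x => Real.exp (-φ x)),
    intervalIntegral.integral_comp_neg (fun x => φ x * Real.exp (-φ x)), neg_neg, neg_neg]

theorem truncatedGibbsEntropy_mono {φ φ' : ℝ → ℝ} (hd : ∀ x, HasDerivAt φ (φ' x) x)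
    (hc : Continuous φ') (ht : ∀ x y, φ x + φ' x * (y - x) ≤ φ y) {a b a₂ b₂ : ℝ}
    (ha : a₂ ≤ a) (hab : a < b) (hb : b ≤ b₂) :
    truncatedGibbsEntropy φ a b ≤ truncatedGibbsEntropy φ a₂ b₂ := by
  refine (truncatedGibbsEntropy_mono_right hd hc ht hab hb).trans ?_
  rw [← truncatedGibbsEntropy_comp_neg, ← truncatedGibbsEntropy_comp_neg φ a₂]
  refine truncatedGibbsEntropy_mono_right (φ' := fun x => -φ' (-x)) (fun x => ?_) (by fun_prop)
    (fun x y => ?_) (neg_lt_neg (hab.trans_le hb)) (neg_le_neg ha)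
  · simpa [Function.comp_def] using (hd (-x)).comp x (hasDerivAt_neg x)
  · linarith [ht (-x) (-y)]

theorem neg_integral_truncated_mul_log {φ : ℝ → ℝ} (hφ : Continuous φ) {a b : ℝ} (hab : a < b) :
    (-∫ x, ((Set.Icc a b).indicator (fun x => Real.exp (-φ x)) x /
          (∫ t in Set.Icc a b, Real.exp (-φ t))) *
        Real.log ((Set.Icc a b).indicator (fun x => Real.exp (-φ x)) x /
          (∫ t in Set.Icc a b, Real.exp (-φ t)))) = truncatedGibbsEntropy φ a b := by
  have hZ := integral_exp_neg_pos hφ hab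
  rw [integral_Icc_eq_integral_Ioc, ← intervalIntegral.integral_of_le hab.le,
    truncatedGibbsEntropy]
  set Z := ∫ x in a..b, Real.exp (-φ x) with hZdef
  have hind : ∀ x, ((Set.Icc a b).indicator (fun x => Real.exp (-φ x)) x / Z) *
      Real.log ((Set.Icc a b).indicator (fun x => Real.exp (-φ x)) x / Z) =
      (Set.Icc a b).indicator (fun x => -(Z⁻¹ * (φ x * Real.exp (-φ x)) +
        Real.log Z * Z⁻¹ * Real.exp (-φ x))) x := by
    intro x
    by_cases hx : x ∈ Set.Icc a b
    · simp only [Set.indicator_of_mem hx]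
      rw [Real.log_div (Real.exp_pos _).ne' hZ.ne', Real.log_exp]
      ring
    · simp [Set.indicator_of_notMem hx]
  simp_rw [hind]
  rw [integral_indicator measurableSet_Icc, integral_Icc_eq_integral_Ioc,
    ← intervalIntegral.integral_of_le hab.le, intervalIntegral.integral_neg,
    intervalIntegral.integral_add (Continuous.intervalIntegrable (by fun_prop) _ _)
      (Continuous.intervalIntegrable (by fun_prop) _ _),
    intervalIntegral.integral_const_mul, intervalIntegral.integral_const_mul, ← hZdef]
  field_simp
  ring

/-- Monotonicity of the differential entropy of a truncated Gaussian in the truncation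
interval: for nested intervals `[l,u] ⊆ [l₂,u₂]`,
`H(f(·;[l,u])) ≤ H(f(·;[l₂,u₂]))`. -/
theorem stmt10 (μ σ : ℝ) (hσ : 0 < σ) (l u l₂ u₂ : ℝ)
    (h1 : l₂ ≤ l) (h2 : l < u) (h3 : u ≤ u₂)
    (f : ℝ → ℝ)
    (hf : f = fun x =>
      (σ * Real.sqrt (2 * Real.pi))⁻¹ * Real.exp (-(x - μ) ^ 2 / (2 * σ ^ 2))) :
    (-∫ x, ((Set.Icc l u).indicator f x / (∫ t in Set.Icc l u, f t)) *
        Real.log ((Set.Icc l u).indicator f x / (∫ t in Set.Icc l u, f t)))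
      ≤ (-∫ x, ((Set.Icc l₂ u₂).indicator f x / (∫ t in Set.Icc l₂ u₂, f t)) *
          Real.log ((Set.Icc l₂ u₂).indicator f x / (∫ t in Set.Icc l₂ u₂, f t))) := by
  set φ : ℝ → ℝ := fun x =>
    (x - μ) ^ 2 / (2 * σ ^ 2) + Real.log (σ * Real.sqrt (2 * Real.pi)) with hφdef
  have hC : 0 < σ * Real.sqrt (2 * Real.pi) := by positivity
  have hfφ : f = fun x => Real.exp (-φ x) := by
    rw [hf]
    funext x
    rw [hφdef]
    simp only [neg_add, Real.exp_add, Real.exp_neg (Real.log _), Real.exp_log hC, neg_div]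
    ring
  have hφ : Continuous φ := by fun_prop
  subst hfφ
  rw [neg_integral_truncated_mul_log hφ h2,
    neg_integral_truncated_mul_log hφ (h1.trans_lt (h2.trans_le h3))]
  refine truncatedGibbsEntropy_mono (φ' := fun x => (x - μ) / σ ^ 2) (fun x => ?_) (by fun_prop)
    (fun x y => ?_) h1 h2 h3
  · have := ((((hasDerivAt_id x).sub_const μ).pow 2).div_const (2 * σ ^ 2)).add_const
      (Real.log (σ * Real.sqrt (2 * Real.pi)))
    refine this.congr_deriv ?_
    simp only [id, Nat.cast_ofNat]
    field_simp
    ring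
  · have : φ y - (φ x + (x - μ) / σ ^ 2 * (y - x)) = (y - x) ^ 2 / (2 * σ ^ 2) := by
      simp only [hφdef]
      field_simp
      ring
    have : 0 ≤ (y - x) ^ 2 / (2 * σ ^ 2) := by positivity
    linarith
end
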